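/- Let F be algebraically closed of characteristic 3 and let f be a nonzero idempotent of the split Okubo algebra (O, *, n). Let C = {x ∈ O | x*f = f*x} be the centralizer of f, rad(C) = {v ∈ C | n(v) = 0 and b(v,w) = 0 for all w ∈ C}, and rank = dim C − dim rad(C). Then exactly one of the following holds: (i) dim C = 6 and rank = 4; (ii) dim C = 4 and rank = 2; (iii) dim C = 4 and rank = 1. -/

import Mathlib

open scoped BigOperators

/-- The grading group `ℤ₃ × ℤ₃`. -/
abbrev OkG : Type := ZMod 3 × ZMod 3

/-- The index set of the standard basis of the split Okubo algebra:
the nonzero elements of `ℤ₃ × ℤ₃`. -/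
abbrev OkI : Type := {g : OkG // g ≠ 0}

variable (R : Type) [CommRing R]

/-- The structure constants `c(g,h) = 1 - ((g₁h₂ - g₂h₁).val : ℤ)` of the split Okubo algebra. -/
def okc (g h : OkG) : R :=
  ((1 - (((g.1 * h.2 - g.2 * h.1 : ZMod 3)).val : ℤ) : ℤ) : R)

/-- Underlying function of the split Okubo multiplication. -/
def okMulFun (x y : OkI → R) : OkI → R := fun k =>
  ∑ g : OkI, ∑ h : OkI,
    (if (g : OkG) + (h : OkG) = (k : OkG) then okc R (g : OkG) (h : OkG) else 0) * (x g * y h)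

/-- The split Okubo multiplication, as a bilinear map: the unique `R`-bilinear map with
`e_g * e_h = 0` if `g + h = 0` and `e_g * e_h = c(g,h) • e_(g+h)` otherwise. -/
def okMul : (OkI → R) →ₗ[R] (OkI → R) →ₗ[R] (OkI → R) :=
  LinearMap.mk₂ R (okMulFun R)
    (by intro m₁ m₂ n; funext k; simp [okMulFun, add_mul, mul_add, Finset.sum_add_distrib])
    (by intro c m n; funext k
        simp only [okMulFun, Pi.smul_apply, smul_eq_mul, Finset.mul_sum]
        exact Finset.sum_congr rfl fun g _ => Finset.sum_congr rfl fun h _ => by ring)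
    (by intro m n₁ n₂; funext k; simp [okMulFun, add_mul, mul_add, Finset.sum_add_distrib])
    (by intro c m n; funext k
        simp only [okMulFun, Pi.smul_apply, smul_eq_mul, Finset.mul_sum]
        exact Finset.sum_congr rfl fun g _ => Finset.sum_congr rfl fun h _ => by ring)

/-- The norm (quadratic form) of the split Okubo algebra: the unique quadratic form
with `n(e_g) = 0` and polar form `b(e_g, e_h) = 1` if `g + h = 0`, and `0` otherwise. -/
def okN (x : OkI → R) : R :=
  x ⟨(1, 0), by decide⟩ * x ⟨(2, 0), by decide⟩ +
  x ⟨(0, 1), by decide⟩ * x ⟨(0, 2), by decide⟩ +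
  x ⟨(1, 1), by decide⟩ * x ⟨(2, 2), by decide⟩ +
  x ⟨(1, 2), by decide⟩ * x ⟨(2, 1), by decide⟩

/-- The polar form of the norm `okN`. -/
def okB (x y : OkI → R) : R := okN R (x + y) - okN R x - okN R y

/-- The basis element `e_g` of the split Okubo algebra. -/
def okE (g : OkI) : OkI → R := Pi.single g 1

/-- The sum `e = ∑_{g ∈ I} e_g` of all eight basis elements. -/
def oke : OkI → R := ∑ g : OkI, okE R g

/-- The centralizer `{x | x * f = f * x}` of `f` in the split Okubo algebra. -/
def okCent (f : OkI → R) : Submodule R (OkI → R) where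
  carrier := {x | okMul R x f = okMul R f x}
  add_mem' := by
    intro a b ha hb
    simp only [Set.mem_setOf_eq] at ha hb ⊢
    simp [map_add, LinearMap.add_apply, ha, hb]
  zero_mem' := by simp
  smul_mem' := by
    intro c a ha
    simp only [Set.mem_setOf_eq] at ha ⊢
    simp [map_smul, LinearMap.smul_apply, ha]

lemma okN_add (x y : OkI → R) : okN R (x + y) = okN R x + okN R y + okB R x y := by
  simp [okB]

lemma okB_add_left (x y z : OkI → R) : okB R (x + y) z = okB R x z + okB R y z := by
  simp [okB, okN]; ring

lemma okN_smul (c : R) (x : OkI → R) : okN R (c • x) = c * c * okN R x := by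
  simp [okN, smul_eq_mul]; ring

lemma okB_smul_left (c : R) (x y : OkI → R) : okB R (c • x) y = c * okB R x y := by
  simp [okB, okN, smul_eq_mul]; ring

/-- The radical of the restriction of the norm `okN` (with polar form `okB`) to the
centralizer of `f`. -/
def okRad (f : OkI → R) : Submodule R (OkI → R) where
  carrier := {v | v ∈ okCent R f ∧ okN R v = 0 ∧ ∀ w ∈ okCent R f, okB R v w = 0}
  add_mem' := by
    intro a b ha hb
    refine ⟨(okCent R f).add_mem ha.1 hb.1, ?_, ?_⟩
    · rw [okN_add, ha.2.1, hb.2.1, ha.2.2 b hb.1]; ring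
    · intro w hw; rw [okB_add_left, ha.2.2 w hw, hb.2.2 w hw]; ring
  zero_mem' := by
    refine ⟨(okCent R f).zero_mem, by simp [okN], ?_⟩
    intro w hw; simp [okB, okN]
  smul_mem' := by
    intro c a ha
    refine ⟨(okCent R f).smul_mem c ha.1, ?_, ?_⟩
    · rw [okN_smul, ha.2.1]; ring
    · intro w hw; rw [okB_smul_left, ha.2.2 w hw]; ring

section okubo

variable (F : Type) [Field F]

lemma okI_sum {M : Type*} [AddCommMonoid M] (φ : OkI → M) :
    ∑ g : OkI, φ g =
      φ ⟨(1, 0), by decide⟩ + φ ⟨(2, 0), by decide⟩ + φ ⟨(0, 1), by decide⟩ +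
      φ ⟨(0, 2), by decide⟩ + φ ⟨(1, 1), by decide⟩ + φ ⟨(2, 2), by decide⟩ +
      φ ⟨(1, 2), by decide⟩ + φ ⟨(2, 1), by decide⟩ := by
  have h : (Finset.univ : Finset OkI) = {⟨(1, 0), by decide⟩, ⟨(2, 0), by decide⟩,
      ⟨(0, 1), by decide⟩, ⟨(0, 2), by decide⟩, ⟨(1, 1), by decide⟩, ⟨(2, 2), by decide⟩,
      ⟨(1, 2), by decide⟩, ⟨(2, 1), by decide⟩} := by decide
  rw [h]
  repeat rw [Finset.sum_insert (by decide)]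
  rw [Finset.sum_singleton]
  simp only [add_assoc]

lemma okc_eq_ite (g h : OkG) :
    okc F g h = if g.1 * h.2 = g.2 * h.1 then 1
      else if g.1 * h.2 = g.2 * h.1 + 1 then 0 else -1 := by
  have key : ∀ z w : ZMod 3, (1 - ((z - w).val : ℤ) : ℤ) =
      if z = w then 1 else if z = w + 1 then 0 else -1 := by decide
  rw [okc, key]
  split_ifs <;> simp

/-- Identify `e_(i,j)` with `x^i y^j` in `F[x, y] / (x^3 - 1, y^3 - 1)`.  These are the coefficients
of an element with respect to the monomials `u, v, u², uv, v², u²v, uv², u²v²` in `u = x - 1` and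
`v = y - 1` (the constant coefficient is left out). -/
def okCoordMap : (OkI → F) →ₗ[F] (Fin 8 → F) where
  toFun x :=
    let x10 := x ⟨(1, 0), by decide⟩
    let x20 := x ⟨(2, 0), by decide⟩
    let x01 := x ⟨(0, 1), by decide⟩
    let x02 := x ⟨(0, 2), by decide⟩
    let x11 := x ⟨(1, 1), by decide⟩
    let x22 := x ⟨(2, 2), by decide⟩
    let x12 := x ⟨(1, 2), by decide⟩
    let x21 := x ⟨(2, 1), by decide⟩
    ![x10 + x11 + x12 + 2 * (x20 + x21 + x22),
      x01 + x11 + x21 + 2 * (x02 + x12 + x22),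
      x20 + x21 + x22,
      x11 + 2 * x12 + 2 * x21 + 4 * x22,
      x02 + x12 + x22,
      x21 + 2 * x22,
      x12 + 2 * x22,
      x22]
  map_add' x y := by ext i; fin_cases i <;> simp <;> ring
  map_smul' c x := by ext i; fin_cases i <;> simp <;> ring

lemma okCoordMap_injective : Function.Injective (okCoordMap F) := by
  rw [← LinearMap.ker_eq_bot, LinearMap.ker_eq_bot']
  intro x hx
  have h := fun i => congrFun hx i
  simp only [okCoordMap, LinearMap.coe_mk, AddHom.coe_mk, Fin.forall_fin_succ] at h
  simp at h
  obtain ⟨h0, h1, h2, h3, h4, h5, h6, h7⟩ := h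
  simp only [h7, mul_zero, add_zero] at h6
  simp only [h7, mul_zero, add_zero] at h5
  simp only [h7, h6, h5, mul_zero, add_zero] at h0 h1 h2 h3 h4
  simp only [h2, h3, h4, mul_zero, add_zero] at h0 h1
  have hs : ∀ g : OkI, x g = 0 := by
    have hcases : ∀ g : OkI, g = ⟨(1, 0), by decide⟩ ∨ g = ⟨(2, 0), by decide⟩ ∨
      g = ⟨(0, 1), by decide⟩ ∨ g = ⟨(0, 2), by decide⟩ ∨ g = ⟨(1, 1), by decide⟩ ∨
      g = ⟨(2, 2), by decide⟩ ∨ g = ⟨(1, 2), by decide⟩ ∨ g = ⟨(2, 1), by decide⟩ := by decide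
    intro g
    rcases hcases g with rfl | rfl | rfl | rfl | rfl | rfl | rfl | rfl <;> assumption
  exact funext hs

/-- The coordinates of `okCoordMap`, as a linear equivalence. -/
noncomputable def okCoord : (OkI → F) ≃ₗ[F] (Fin 8 → F) :=
  LinearEquiv.ofInjectiveOfFinrankEq (okCoordMap F) (okCoordMap_injective F) (by
    have : Fintype.card OkI = 8 := by decide
    simp [this])

/-- The value on the element with coordinates `c` of the linear form `1 ↦ 1, e_g ↦ 0`; the scalar
`-okTr c` is the constant term left out by the coordinates `c`. -/
def okTr (c : Fin 8 → F) : F :=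
  c 2 + c 3 + c 4 - c 0 - c 1 - c 5 - c 6 + c 7

/-- The coefficients of the product of the two polynomials without constant term with
coefficients `c` and `d`. -/
def okProd (c d : Fin 8 → F) : Fin 8 → F :=
  ![0, 0, c 0 * d 0, c 0 * d 1 + c 1 * d 0, c 1 * d 1,
    c 0 * d 3 + c 3 * d 0 + c 1 * d 2 + c 2 * d 1,
    c 0 * d 4 + c 4 * d 0 + c 1 * d 3 + c 3 * d 1,
    c 0 * d 6 + c 6 * d 0 + c 1 * d 5 + c 5 * d 1 + c 2 * d 4 + c 4 * d 2 + c 3 * d 3]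

lemma okCoord_apply (x : OkI → F) : okCoord F x = okCoordMap F x := rfl

/-- The permutation of the monomials which exchanges the two variables. -/
def okMonomialSwap : Equiv.Perm (Fin 8) where
  toFun := ![1, 0, 4, 3, 2, 6, 5, 7]
  invFun := ![1, 0, 4, 3, 2, 6, 5, 7]
  left_inv := by decide
  right_inv := by decide

/-- The linear automorphism which exchanges the two variables. -/
noncomputable def okSwap : (OkI → F) ≃ₗ[F] (OkI → F) :=
  (okCoord F).trans ((LinearEquiv.funCongrLeft F F okMonomialSwap).trans (okCoord F).symm)

lemma okCoord_okSwap (x : OkI → F) :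
    okCoord F (okSwap F x) = okCoord F x ∘ okMonomialSwap := by
  simp [okSwap, LinearEquiv.funCongrLeft, LinearMap.funLeft]

lemma okCoord_okSwap_apply (x : OkI → F) :
    okCoord F (okSwap F x) 0 = okCoord F x 1 ∧ okCoord F (okSwap F x) 1 = okCoord F x 0 ∧
    okCoord F (okSwap F x) 2 = okCoord F x 4 ∧ okCoord F (okSwap F x) 3 = okCoord F x 3 ∧
    okCoord F (okSwap F x) 4 = okCoord F x 2 ∧ okCoord F (okSwap F x) 5 = okCoord F x 6 ∧
    okCoord F (okSwap F x) 6 = okCoord F x 5 ∧ okCoord F (okSwap F x) 7 = okCoord F x 7 := by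
  rw [okCoord_okSwap]
  generalize okCoord F x = c
  simp [okMonomialSwap]

/-- A subspace which projects bijectively onto `m` of the coordinates has dimension `m`. -/
lemma finrank_eq_of_coord (S : Submodule F (OkI → F)) {m : ℕ} (ι : Fin m → Fin 8)
    (hinj : ∀ x ∈ S, (∀ i, okCoord F x (ι i) = 0) → okCoord F x = 0)
    (hsurj : ∀ y : Fin m → F, ∃ c, (okCoord F).symm c ∈ S ∧ ∀ i, c (ι i) = y i) :
    Module.finrank F S = m := by
  let φ : S →ₗ[F] (Fin m → F) := LinearMap.funLeft F F ι ∘ₗ (okCoord F).toLinearMap ∘ₗ S.subtype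
  have hφ : Function.Bijective φ := by
    constructor
    · rw [← LinearMap.ker_eq_bot, LinearMap.ker_eq_bot']
      intro x hx
      have := hinj x x.2 fun i => congrFun hx i
      simpa using this
    · intro y
      obtain ⟨c, hc, h⟩ := hsurj y
      exact ⟨⟨_, hc⟩, funext fun i => by simp [φ, LinearMap.funLeft, h]⟩
  rw [(LinearEquiv.ofBijective φ hφ).finrank_eq, Module.finrank_fin_fun]

lemma eq_vec_eight {α : Type*} {c : Fin 8 → α} {a₀ a₁ a₂ a₃ a₄ a₅ a₆ a₇ : α}
    (h₀ : c 0 = a₀) (h₁ : c 1 = a₁) (h₂ : c 2 = a₂) (h₃ : c 3 = a₃) (h₄ : c 4 = a₄)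
    (h₅ : c 5 = a₅) (h₆ : c 6 = a₆) (h₇ : c 7 = a₇) : c = ![a₀, a₁, a₂, a₃, a₄, a₅, a₆, a₇] := by
  ext i
  fin_cases i <;> assumption

variable [CharP F 3]

lemma okB_eq (x y : OkI → F) : okB F x y =
    okTr F (okProd F (okCoord F x) (okCoord F y)) - okTr F (okCoord F x) * okTr F (okCoord F y) := by
  simp only [okCoord_apply, okTr, okProd, okCoordMap, LinearMap.coe_mk, AddHom.coe_mk, okB, okN]
  simp
  grind

set_option maxHeartbeats 4000000 in
lemma okCoord_mul_self (x : OkI → F) : okCoord F (okMul F x x) =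
    okProd F (okCoord F x) (okCoord F x) + okTr F (okCoord F x) • okCoord F x := by
  simp only [okCoord_apply, okTr, okProd, okCoordMap, LinearMap.coe_mk, AddHom.coe_mk]
  simp only [okMul, LinearMap.mk₂_apply, okMulFun, okI_sum, okc_eq_ite]
  ext i
  fin_cases i <;> simp +decide <;> grind

set_option maxHeartbeats 4000000 in
/-- The coordinates of a commutator: those of `(1 + u) (1 + v) J`, with `J` the Jacobian determinant
of the two polynomials. -/
lemma okCoord_comm (x y : OkI → F) :
    okCoord F (okMul F x y - okMul F y x) =
      let c := okCoord F x
      let d := okCoord F y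
      let J00 := c 0 * d 1 - c 1 * d 0
      let J10 := c 0 * d 3 + 2 * c 2 * d 1 - 2 * c 1 * d 2 - c 3 * d 0
      let J01 := 2 * c 0 * d 4 + c 3 * d 1 - c 1 * d 3 - 2 * c 4 * d 0
      let J20 := c 0 * d 5 + 2 * c 2 * d 3 - 2 * c 3 * d 2 - c 5 * d 0
      let J11 := 2 * c 0 * d 6 + c 2 * d 4 + 2 * c 5 * d 1 - 2 * c 1 * d 5 - c 4 * d 2 - 2 * c 6 * d 0
      let J02 := 2 * c 3 * d 4 + c 6 * d 1 - c 1 * d 6 - 2 * c 4 * d 3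
      let J21 := 2 * c 0 * d 7 + c 2 * d 6 - c 3 * d 5 + c 5 * d 3 - c 6 * d 2 - 2 * c 7 * d 0
      let J12 := c 3 * d 6 + c 5 * d 4 - c 6 * d 3 + 2 * c 7 * d 1 - 2 * c 1 * d 7 - c 4 * d 5
      ![J10 + J00, J01 + J00, J20 + J10, J11 + J10 + J01 + J00, J02 + J01,
        J21 + J20 + J11 + J10, J12 + J11 + J02 + J01, J21 + J12 + J11] := by
  simp only [okCoord_apply, okCoordMap, LinearMap.coe_mk, AddHom.coe_mk]
  simp only [okMul, LinearMap.mk₂_apply, okMulFun, okI_sum, okc_eq_ite, Pi.sub_apply]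
  ext i
  fin_cases i <;> simp +decide <;> grind

lemma two_ne_zero_of_char_three : (2 : F) ≠ 0 := by
  intro h
  have h3 : (3 : F) = 0 := CharP.cast_eq_zero F 3
  exact one_ne_zero (α := F) (by linear_combination h3 - h)

/-- An idempotent is, up to the constant term, a polynomial of square zero. -/
lemma okCoord_of_idempotent (f : OkI → F) (hf : okMul F f f = f) (hf0 : f ≠ 0) :
    okCoord F f 0 = 0 ∧ okCoord F f 1 = 0 ∧
      okCoord F f 3 ^ 2 = okCoord F f 2 * okCoord F f 4 := by
  have h := okCoord_mul_self F f
  rw [hf] at h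
  have hc0 : okCoord F f ≠ 0 := by simpa using hf0
  generalize okCoord F f = c at h hc0
  generalize okTr F c = t at h
  have h := fun i => congrFun h i
  simp [okProd, Fin.forall_fin_succ] at h
  obtain ⟨h0, h1, h2, h3, h4, h5, h6, h7⟩ := h
  by_cases ht : t = 1
  · subst ht
    have e0 : c 0 = 0 := by simpa using h2
    have e1 : c 1 = 0 := by simpa using h4
    refine ⟨e0, e1, ?_⟩
    simp only [e0, e1] at h7
    grind
  · have cancel : ∀ z, z = t * z → z = 0 := fun z hz => by
      have : (1 - t) * z = 0 := by linear_combination hz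
      exact (mul_eq_zero.mp this).resolve_left (sub_ne_zero.mpr (Ne.symm ht))
    have e0 := cancel (c 0) (by grind)
    have e1 := cancel (c 1) (by grind)
    have e2 := cancel (c 2) (by grind)
    have e3 := cancel (c 3) (by grind)
    have e4 := cancel (c 4) (by grind)
    have e5 := cancel (c 5) (by grind)
    have e6 := cancel (c 6) (by grind)
    have e7 := cancel (c 7) (by grind)
    exact absurd (funext fun i => by fin_cases i <;> assumption) hc0

/-- The centralizer is given by the vanishing of the Jacobian determinant. -/
lemma mem_okCent_iff (f x : OkI → F) (h0 : okCoord F f 0 = 0) (h1 : okCoord F f 1 = 0) :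
    x ∈ okCent F f ↔
      let c := okCoord F f
      let d := okCoord F x
      2 * c 2 * d 1 = c 3 * d 0 ∧ c 3 * d 1 = 2 * c 4 * d 0 ∧
      2 * c 2 * d 3 = 2 * c 3 * d 2 + c 5 * d 0 ∧
      c 2 * d 4 + 2 * c 5 * d 1 = c 4 * d 2 + 2 * c 6 * d 0 ∧
      2 * c 3 * d 4 + c 6 * d 1 = 2 * c 4 * d 3 ∧
      c 2 * d 6 + c 5 * d 3 = c 3 * d 5 + c 6 * d 2 + 2 * c 7 * d 0 ∧
      c 3 * d 6 + c 5 * d 4 + 2 * c 7 * d 1 = c 6 * d 3 + c 4 * d 5 := by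
  have hx : x ∈ okCent F f ↔ okCoord F (okMul F f x - okMul F x f) = 0 := by
    rw [LinearEquiv.map_eq_zero_iff, sub_eq_zero]
    exact eq_comm
  rw [hx, okCoord_comm]
  generalize okCoord F x = d
  generalize okCoord F f = c at h0 h1
  simp only [funext_iff, Fin.forall_fin_succ, h0, h1]
  simp
  constructor
  · rintro ⟨a0, a1, a2, a3, a4, a5, a6, a7⟩
    refine ⟨?_, ?_, ?_, ?_, ?_, ?_, ?_⟩ <;> grind
  · rintro ⟨a1, a2, a3, a4, a5, a6, a7⟩
    refine ⟨?_, ?_, ?_, ?_, ?_, ?_, ?_, ?_⟩ <;> grind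

lemma mem_okRad_iff (f x : OkI → F) :
    x ∈ okRad F f ↔ x ∈ okCent F f ∧ ∀ d : Fin 8 → F, (okCoord F).symm d ∈ okCent F f →
      okTr F (okProd F (okCoord F x) d) = okTr F (okCoord F x) * okTr F d := by
  constructor
  · rintro ⟨h1, -, h3⟩
    refine ⟨h1, fun d hd => ?_⟩
    have := h3 _ hd
    rw [okB_eq, LinearEquiv.apply_symm_apply] at this
    exact sub_eq_zero.mp this
  · rintro ⟨h1, h2⟩
    have h3 : ∀ w ∈ okCent F f, okB F x w = 0 := fun w hw => by
      rw [okB_eq, sub_eq_zero]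
      exact h2 _ (by simpa using hw)
    refine ⟨h1, ?_, h3⟩
    have h := h3 x h1
    have : okB F x x = 2 * okN F x := by simp [okB, okN]; ring
    rw [this] at h
    exact (mul_eq_zero.mp h).resolve_left (two_ne_zero_of_char_three F)

/-- If `f` is a constant plus a nonzero multiple of `u²v²`,
then the dimensions are those of a quaternionic idempotent. -/
lemma finrank_quaternionic (f : OkI → F) (k : F) (hk : k ≠ 0)
    (hf : okCoord F f = ![0, 0, 0, 0, 0, 0, 0, k]) :
    Module.finrank F (okCent F f) = 6 ∧ Module.finrank F (okRad F f) = 2 := by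
  have h2 := two_ne_zero_of_char_three F
  have hC : ∀ x, x ∈ okCent F f ↔ okCoord F x 0 = 0 ∧ okCoord F x 1 = 0 := fun x => by
    rw [mem_okCent_iff F f x (by simp [hf]) (by simp [hf]), hf]
    simp [hk, h2]
  have hR : ∀ x, x ∈ okRad F f ↔ okCoord F x 0 = 0 ∧ okCoord F x 1 = 0 ∧ okCoord F x 2 = 0 ∧
      okCoord F x 3 = 0 ∧ okCoord F x 4 = 0 ∧
      okCoord F x 7 = okCoord F x 5 + okCoord F x 6 := fun x => by
    simp only [mem_okRad_iff, hC, LinearEquiv.apply_symm_apply]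
    generalize okCoord F x = c
    constructor
    · rintro ⟨⟨e0, e1⟩, h⟩
      have hs := h ![0, 0, 0, 0, 0, 0, 0, 1] (by simp)
      have a2 := h ![0, 0, 0, 0, 1, 0, 0, 0] (by simp)
      have a3 := h ![0, 0, 0, 1, 0, 0, 0, 0] (by simp)
      have a4 := h ![0, 0, 1, 0, 0, 0, 0, 0] (by simp)
      simp [okTr, okProd, e0, e1] at hs a2 a3 a4
      grind
    · rintro ⟨e0, e1, e2, e3, e4, e7⟩
      refine ⟨⟨e0, e1⟩, fun d ⟨d0, d1⟩ => ?_⟩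
      simp [okTr, okProd, e0, e1, e2, e3, e4, e7, d0, d1]
  constructor
  · apply finrank_eq_of_coord F _ ![2, 3, 4, 5, 6, 7]
    · intro x hx h
      rw [hC] at hx
      simp [Fin.forall_fin_succ] at h
      ext i; fin_cases i <;> simp [hx, h]
    · intro y
      refine ⟨![0, 0, y 0, y 1, y 2, y 3, y 4, y 5], ?_, ?_⟩
      · simp [hC]
      · simp [Fin.forall_fin_succ]
  · apply finrank_eq_of_coord F _ ![5, 6]
    · intro x hx h
      rw [hR] at hx
      simp [Fin.forall_fin_succ] at h
      ext i; fin_cases i <;> simp [hx, h]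
    · intro y
      refine ⟨![0, 0, 0, 0, 0, y 0, y 1, y 0 + y 1], ?_, ?_⟩
      · simp [hR]
      · simp [Fin.forall_fin_succ]

/-- If `f` is a constant plus a form of degree three plus a multiple of `u²v²`, then
the dimensions are those of a singular idempotent. -/
lemma finrank_singular (f : OkI → F) (d ν k : F) (hd : d ≠ 0)
    (hf : okCoord F f = ![0, 0, 0, 0, 0, d, d * ν, k]) :
    Module.finrank F (okCent F f) = 4 ∧ Module.finrank F (okRad F f) = 3 := by
  have h2 := two_ne_zero_of_char_three F
  have hC : ∀ x, x ∈ okCent F f ↔ okCoord F x 0 = 0 ∧ okCoord F x 1 = 0 ∧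
      okCoord F x 3 = ν * okCoord F x 2 ∧ okCoord F x 4 = ν ^ 2 * okCoord F x 2 := fun x => by
    rw [mem_okCent_iff F f x (by simp [hf]) (by simp [hf]), hf]
    generalize okCoord F x = c
    simp [hd]
    grind
  have hR : ∀ x, x ∈ okRad F f ↔ x ∈ okCent F f ∧ okTr F (okCoord F x) = 0 := fun x => by
    simp only [mem_okRad_iff, hC, LinearEquiv.apply_symm_apply]
    generalize okCoord F x = c
    refine and_congr_right ?_
    rintro ⟨e0, e1, e3, e4⟩
    constructor
    · intro h
      have hs := h ![0, 0, 0, 0, 0, 0, 0, 1] (by simp)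
      simpa [okTr, okProd, e0, e1] using hs.symm
    · rintro h d ⟨d0, d1, d3, d4⟩
      rw [h]
      simp [okTr, okProd, e0, e1, e3, e4, d0, d1, d3, d4]
      grind
  constructor
  · apply finrank_eq_of_coord F _ ![2, 5, 6, 7]
    · intro x hx h
      rw [hC] at hx
      simp [Fin.forall_fin_succ] at h
      ext i; fin_cases i <;> simp [hx, h]
    · intro y
      refine ⟨![0, 0, y 0, ν * y 0, ν ^ 2 * y 0, y 1, y 2, y 3], ?_, ?_⟩
      · simp [hC]
      · simp [Fin.forall_fin_succ]
  · apply finrank_eq_of_coord F _ ![2, 5, 6]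
    · intro x hx h
      rw [hR, hC] at hx
      obtain ⟨hx, ht⟩ := hx
      simp [Fin.forall_fin_succ] at h
      simp [okTr, hx, h] at ht
      ext i; fin_cases i <;> simp [hx, h, ht]
    · intro y
      refine ⟨![0, 0, y 0, ν * y 0, ν ^ 2 * y 0, y 1, y 2,
        y 1 + y 2 - (1 + ν + ν ^ 2) * y 0], ?_, ?_⟩
      · simp [hR, hC, okTr]
        ring
      · simp [Fin.forall_fin_succ]

/-- If the quadratic part of `f` is a nonzero square, then the dimensions are those of a
quadratic or singular idempotent. -/
lemma finrank_of_quadratic_part_ne_zero (f : OkI → F) (a μ d e k : F) (ha : a ≠ 0)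
    (hf : okCoord F f = ![0, 0, a, a * μ, a * μ ^ 2, a * d, a * e, a * k]) :
    Module.finrank F (okCent F f) = 4 ∧
      (Module.finrank F (okRad F f) = 2 ∨ Module.finrank F (okRad F f) = 3) := by
  have h2 := two_ne_zero_of_char_three F
  have hC : ∀ x, x ∈ okCent F f ↔ okCoord F x 1 = -μ * okCoord F x 0 ∧
      okCoord F x 3 = μ * okCoord F x 2 - d * okCoord F x 0 ∧
      okCoord F x 4 = μ ^ 2 * okCoord F x 2 + (2 * e + 2 * d * μ) * okCoord F x 0 ∧
      okCoord F x 6 = μ * okCoord F x 5 + (e - d * μ) * okCoord F x 2 +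
        (2 * k + d ^ 2) * okCoord F x 0 := fun x => by
    rw [mem_okCent_iff F f x (by simp [hf]) (by simp [hf]), hf]
    generalize okCoord F x = c
    simp
    constructor
    · rintro ⟨h1, -, h3, h4, -, h6, -⟩
      have e1 : c 1 = -(μ * c 0) := mul_left_cancel₀ ha (by grind)
      have e3 : c 3 = μ * c 2 - d * c 0 := mul_left_cancel₀ ha (by grind)
      refine ⟨e1, e3, mul_left_cancel₀ ha ?_, mul_left_cancel₀ ha ?_⟩ <;> grind
    · rintro ⟨h1, h3, h4, h6⟩
      simp only [h1, h3, h4, h6]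
      refine ⟨?_, ?_, ?_, ?_, ?_, ?_, ?_⟩ <;> grind
  obtain ⟨κ, hκ⟩ : ∃ κ, ∀ x ∈ okCent F f, ∀ y ∈ okCent F f,
      okTr F (okProd F (okCoord F x) (okCoord F y)) = κ * okCoord F x 0 * okCoord F y 0 := by
    refine ⟨okTr F (okProd F
      ![1, -μ, 0, -d, 2 * e + 2 * d * μ, 0, 2 * k + d ^ 2, 0]
      ![1, -μ, 0, -d, 2 * e + 2 * d * μ, 0, 2 * k + d ^ 2, 0]), ?_⟩
    intro x hx y hy
    rw [hC] at hx hy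
    simp [okTr, okProd, hx, hy]
    grind
  have hR : ∀ x, x ∈ okRad F f ↔
      x ∈ okCent F f ∧ okTr F (okCoord F x) = 0 ∧ κ * okCoord F x 0 = 0 := fun x => by
    rw [mem_okRad_iff]
    refine and_congr_right fun hx => ?_
    constructor
    · intro h
      have hs := h ![0, 0, 0, 0, 0, 0, 0, 1] (by simp [hC])
      have ht : okTr F (okCoord F x) = 0 := by
        have := hκ x hx ((okCoord F).symm ![0, 0, 0, 0, 0, 0, 0, 1]) (by simp [hC])
        rw [LinearEquiv.apply_symm_apply, hs] at this
        simpa [okTr] using this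
      have hw' : (okCoord F).symm ![1, -μ, 0, -d, 2 * e + 2 * d * μ, 0, 2 * k + d ^ 2, 0] ∈
        okCent F f := by simp [hC]
      have hw := hκ x hx _ hw'
      rw [LinearEquiv.apply_symm_apply, h _ hw', ht] at hw
      exact ⟨ht, by simpa using hw.symm⟩
    · rintro ⟨ht, h0⟩ d hd
      have := hκ x hx _ hd
      rw [LinearEquiv.apply_symm_apply] at this
      rw [this, ht, h0, zero_mul, zero_mul]
  constructor
  · apply finrank_eq_of_coord F _ ![0, 2, 5, 7]
    · intro x hx h
      rw [hC] at hx
      simp [Fin.forall_fin_succ] at h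
      ext i; fin_cases i <;> simp [hx, h]
    · intro y
      refine ⟨![y 0, -μ * y 0, y 1, μ * y 1 - d * y 0,
        μ ^ 2 * y 1 + (2 * e + 2 * d * μ) * y 0, y 2,
        μ * y 2 + (e - d * μ) * y 1 + (2 * k + d ^ 2) * y 0, y 3], ?_, ?_⟩
      · simp [hC]
      · simp [Fin.forall_fin_succ]
  · have hT : ∀ y : Fin 3 → F, ∃ c, (okCoord F).symm c ∈ okCent F f ∧ okTr F c = 0 ∧
        c 0 = y 0 ∧ c 2 = y 1 ∧ c 5 = y 2 := fun y => by
      refine ⟨![y 0, -μ * y 0, y 1, μ * y 1 - d * y 0,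
        μ ^ 2 * y 1 + (2 * e + 2 * d * μ) * y 0, y 2,
        μ * y 2 + (e - d * μ) * y 1 + (2 * k + d ^ 2) * y 0,
        -okTr F ![y 0, -μ * y 0, y 1, μ * y 1 - d * y 0,
        μ ^ 2 * y 1 + (2 * e + 2 * d * μ) * y 0, y 2,
        μ * y 2 + (e - d * μ) * y 1 + (2 * k + d ^ 2) * y 0, 0]], ?_, ?_, ?_⟩
      · simp [hC]
      · simp [okTr]
      · simp
    have hZ : ∀ x ∈ okCent F f, okTr F (okCoord F x) = 0 → okCoord F x 0 = 0 →
        okCoord F x 2 = 0 → okCoord F x 5 = 0 → okCoord F x = 0 := by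
      intro x hx ht h0 h2 h5
      rw [hC] at hx
      simp [okTr, hx, h0, h2, h5] at ht
      ext i; fin_cases i <;> simp [hx, h0, h2, h5, ht]
    by_cases hκ0 : κ = 0
    · right
      apply finrank_eq_of_coord F _ ![0, 2, 5]
      · intro x hx h
        rw [hR] at hx
        simp [Fin.forall_fin_succ] at h
        exact hZ x hx.1 hx.2.1 h.1 h.2.1 h.2.2
      · intro y
        obtain ⟨c, hc, ht, h0, h2, h5⟩ := hT y
        refine ⟨c, ?_, ?_⟩
        · simp [hR, hc, ht, hκ0]
        · simp [Fin.forall_fin_succ, h0, h2, h5]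
    · left
      apply finrank_eq_of_coord F _ ![2, 5]
      · intro x hx h
        rw [hR] at hx
        simp [Fin.forall_fin_succ] at h
        exact hZ x hx.1 hx.2.1 ((mul_eq_zero.mp hx.2.2).resolve_left hκ0) h.1 h.2
      · intro y
        obtain ⟨c, hc, ht, h0, h2, h5⟩ := hT ![0, y 0, y 1]
        simp at h0 h2 h5
        refine ⟨c, ?_, ?_⟩
        · simp [hR, hc, ht, h0]
        · simp [Fin.forall_fin_succ, h2, h5]

lemma okSwap_mem_okCent_iff (f x : OkI → F) (h0 : okCoord F f 0 = 0) (h1 : okCoord F f 1 = 0) :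
    okSwap F x ∈ okCent F (okSwap F f) ↔ x ∈ okCent F f := by
  have hf := okCoord_okSwap_apply F f
  have hx := okCoord_okSwap_apply F x
  rw [mem_okCent_iff F f x h0 h1, mem_okCent_iff F (okSwap F f) _
    (hf.1.trans h1) (hf.2.1.trans h0)]
  simp only [hf, hx]
  constructor <;> rintro ⟨a1, a2, a3, a4, a5, a6, a7⟩ <;>
    refine ⟨?_, ?_, ?_, ?_, ?_, ?_, ?_⟩
  all_goals first
    | linear_combination -a1 | linear_combination -a2 | linear_combination -a3
    | linear_combination -a4 | linear_combination -a5 | linear_combination -a6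
    | linear_combination -a7

lemma okSwap_mem_okRad_iff (f x : OkI → F) (h0 : okCoord F f 0 = 0) (h1 : okCoord F f 1 = 0) :
    okSwap F x ∈ okRad F (okSwap F f) ↔ x ∈ okRad F f := by
  have hN : ∀ x, okN F (okSwap F x) = okN F x := fun x => by
    refine mul_left_cancel₀ (two_ne_zero_of_char_three F) ?_
    have hB : ∀ x, 2 * okN F x = okB F x x := fun x => by simp [okB, okN]; ring
    rw [hB, hB, okB_eq, okB_eq]
    simp [okCoord_okSwap_apply, okTr, okProd]
    ring
  have hB : ∀ x y, okB F (okSwap F x) (okSwap F y) = okB F x y := fun x y => by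
    simp only [okB, ← map_add, hN]
  refine and_congr (okSwap_mem_okCent_iff F f x h0 h1) (and_congr (by rw [hN]) ?_)
  rw [(okSwap F).surjective.forall]
  simp only [hB, okSwap_mem_okCent_iff F f _ h0 h1]

lemma finrank_okSwap (f : OkI → F) (h0 : okCoord F f 0 = 0) (h1 : okCoord F f 1 = 0) :
    Module.finrank F (okCent F (okSwap F f)) = Module.finrank F (okCent F f) ∧
      Module.finrank F (okRad F (okSwap F f)) = Module.finrank F (okRad F f) := by
  have hC : (okCent F f).map (okSwap F).toLinearMap = okCent F (okSwap F f) := by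
    ext x
    obtain ⟨x, rfl⟩ := (okSwap F).surjective x
    simp [okSwap_mem_okCent_iff F f x h0 h1]
  have hR : (okRad F f).map (okSwap F).toLinearMap = okRad F (okSwap F f) := by
    ext x
    obtain ⟨x, rfl⟩ := (okSwap F).surjective x
    simp [okSwap_mem_okRad_iff F f x h0 h1]
  rw [← hC, ← hR, LinearEquiv.finrank_map_eq, LinearEquiv.finrank_map_eq]
  exact ⟨rfl, rfl⟩

lemma finrank_of_okCoord_two_ne_zero (f : OkI → F) (h0 : okCoord F f 0 = 0)
    (h1 : okCoord F f 1 = 0) (h3 : okCoord F f 3 ^ 2 = okCoord F f 2 * okCoord F f 4)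
    (ha : okCoord F f 2 ≠ 0) :
    Module.finrank F (okCent F f) = 4 ∧
      (Module.finrank F (okRad F f) = 2 ∨ Module.finrank F (okRad F f) = 3) := by
  apply finrank_of_quadratic_part_ne_zero F f (okCoord F f 2) (okCoord F f 3 / okCoord F f 2)
    (okCoord F f 5 / okCoord F f 2) (okCoord F f 6 / okCoord F f 2)
    (okCoord F f 7 / okCoord F f 2) ha
  refine eq_vec_eight h0 h1 rfl (mul_div_cancel₀ _ ha).symm ?_ (mul_div_cancel₀ _ ha).symm
    (mul_div_cancel₀ _ ha).symm (mul_div_cancel₀ _ ha).symm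
  rw [div_pow, h3]
  field_simp

end okubo

/-- Over an algebraically closed field of characteristic `3`, for any
nonzero idempotent `f` of the split Okubo algebra, with `C` the centralizer of `f` and
`rank = dim C - dim rad(C)` the rank of the restriction of the norm to `C`, exactly one
of the following holds: `(dim C, rank) = (6,4)`, `(4,2)` or `(4,1)`. -/
theorem okubo_idempotent_trichotomy (F : Type) [Field F] [IsAlgClosed F] [CharP F 3]
    (f : OkI → F) (hf : okMul F f f = f) (hf0 : f ≠ 0) :
    (Module.finrank F (okCent F f) = 6 ∧
      Module.finrank F (okCent F f) - Module.finrank F (okRad F f) = 4) ∨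
    (Module.finrank F (okCent F f) = 4 ∧
      Module.finrank F (okCent F f) - Module.finrank F (okRad F f) = 2) ∨
    (Module.finrank F (okCent F f) = 4 ∧
      Module.finrank F (okCent F f) - Module.finrank F (okRad F f) = 1) := by
  obtain ⟨h0, h1, h3⟩ := okCoord_of_idempotent F f hf hf0
  obtain ⟨hSC, hSR⟩ := finrank_okSwap F f h0 h1
  obtain ⟨s0, s1, s2, s3, s4, s5, s6, s7⟩ := okCoord_okSwap_apply F f
  by_cases ha : okCoord F f 2 = 0
  · have hb : okCoord F f 3 = 0 := by simpa [ha] using h3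
    by_cases hc : okCoord F f 4 = 0
    · by_cases hd : okCoord F f 5 = 0
      · by_cases he : okCoord F f 6 = 0
        · have hk : okCoord F f 7 ≠ 0 := fun hk => hf0 <| (okCoord F).map_eq_zero_iff.mp <|
            (eq_vec_eight h0 h1 ha hb hc hd he hk).trans (by simp)
          have := finrank_quaternionic F f _ hk (eq_vec_eight h0 h1 ha hb hc hd he rfl)
          omega
        · have := finrank_singular F (okSwap F f) (okCoord F f 6) 0 (okCoord F f 7) he
            (eq_vec_eight (s0.trans h1) (s1.trans h0) (s2.trans hc) (s3.trans hb) (s4.trans ha) s5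
              (s6.trans (hd.trans (mul_zero _).symm)) s7)
          omega
      · have := finrank_singular F f (okCoord F f 5) (okCoord F f 6 / okCoord F f 5)
          (okCoord F f 7) hd
          (eq_vec_eight h0 h1 ha hb hc rfl (mul_div_cancel₀ _ hd).symm rfl)
        omega
    · have := finrank_of_okCoord_two_ne_zero F (okSwap F f) (s0.trans h1) (s1.trans h0)
        (by rw [s2, s3, s4, h3, mul_comm]) (by rwa [s2])
      omega
  · have := finrank_of_okCoord_two_ne_zero F f h0 h1 h3 ha
    omega
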